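/- Let G be a finite group and N a normal subgroup of G such that G/N is isomorphic to a symmetric group S_m. If α(G) = α(G/N), then N is an elementary abelian 2-group admitting a normal complement in G, so that G ≅ N × (G/N). -/

import Mathlib

open scoped Classical

/-- The number of cyclic subgroups of a group. -/
noncomputable def numCyclic (G : Type*) [Group G] : ℕ :=
  Nat.card {H : Subgroup G // IsCyclic (↥H)}

/-- `alpha G = c(G) / |G|`, the number of cyclic subgroups divided by the order. -/
noncomputable def alpha (G : Type*) [Group G] : ℚ :=
  (numCyclic G : ℚ) / (Nat.card G : ℚ)

theorem card_zpowers_eq_of_isCyclic {G : Type*} [Group G] [Fintype G] (C : Subgroup G)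
    [IsCyclic C] :
    (Finset.univ.filter fun g : G => Subgroup.zpowers g = C).card =
      Nat.totient (Fintype.card C) := by
  rw [← IsCyclic.card_orderOf_eq_totient (α := C) dvd_rfl,
    ← Finset.card_map (Function.Embedding.subtype (· ∈ C))]
  congr 1
  ext g
  simp only [Finset.mem_filter, Finset.mem_univ, true_and, Finset.mem_map,
    Function.Embedding.subtype_apply]
  constructor
  · rintro rfl
    exact ⟨⟨g, Subgroup.mem_zpowers g⟩, by
      rw [← Subgroup.orderOf_coe, Fintype.card_zpowers], rfl⟩
  · rintro ⟨x, hx, rfl⟩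
    refine Subgroup.eq_of_le_of_card_ge (Subgroup.zpowers_le.2 x.2) ?_
    rw [Nat.card_zpowers, Subgroup.orderOf_coe, hx, Nat.card_eq_fintype_card]

theorem numCyclic_eq_sum_inv_totient (G : Type*) [Group G] [Fintype G] :
    (numCyclic G : ℚ) = ∑ g : G, ((Nat.totient (orderOf g) : ℚ))⁻¹ := by
  let f : G → {H : Subgroup G // IsCyclic H} := fun g => ⟨Subgroup.zpowers g, inferInstance⟩
  rw [← Finset.sum_fiberwise (s := Finset.univ) (g := f), numCyclic, Nat.card_eq_fintype_card,
    Fintype.card, Finset.card_eq_sum_ones, Nat.cast_sum]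
  refine Finset.sum_congr rfl fun C _ => ?_
  obtain ⟨C, hC⟩ := C
  have h1 : ∀ g ∈ Finset.univ.filter (fun g => f g = ⟨C, hC⟩),
      ((Nat.totient (orderOf g) : ℚ))⁻¹ = ((Nat.totient (Fintype.card C) : ℚ))⁻¹ := by
    intro g hg
    have hg' : Subgroup.zpowers g = C := congrArg Subtype.val (Finset.mem_filter.1 hg).2
    subst hg'
    rw [Fintype.card_zpowers]
  have h2 : (Finset.univ.filter fun g => f g = ⟨C, hC⟩) =
      Finset.univ.filter fun g : G => Subgroup.zpowers g = C := by
    ext g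
    simp [f]
  rw [Finset.sum_congr rfl h1, Finset.sum_const, h2, card_zpowers_eq_of_isCyclic, nsmul_eq_mul,
    mul_inv_cancel₀]
  · simp
  · have : 0 < Nat.totient (Fintype.card C) := Nat.totient_pos.2 Fintype.card_pos
    positivity

theorem sum_comp_div_card_of_surjective {G Q : Type*} [Group G] [Group Q] [Fintype G] [Fintype Q]
    (f : G →* Q) (hf : Function.Surjective f) (F : Q → ℚ) :
    (∑ g, F (f g)) / (Nat.card G : ℚ) = (∑ q, F q) / (Nat.card Q : ℚ) := by
  have key : ∀ F : Q → ℚ, ∑ g, F (f g) =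
      ((Finset.univ.filter fun g => f g = 1).card : ℚ) * ∑ q, F q := by
    intro F
    rw [← Finset.sum_fiberwise (s := Finset.univ) (g := f), Finset.mul_sum]
    refine Finset.sum_congr rfl fun q _ => ?_
    rw [Finset.sum_congr rfl (g := fun _ => F q)
      (fun g hg => by rw [(Finset.mem_filter.1 hg).2]), Finset.sum_const, nsmul_eq_mul,
      MonoidHom.card_fiber_eq_of_mem_range f (hf q) (hf 1)]
  have hc : (Nat.card G : ℚ) =
      ((Finset.univ.filter fun g => f g = 1).card : ℚ) * (Nat.card Q : ℚ) := by
    simpa [Nat.card_eq_fintype_card] using key fun _ => 1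
  have h0 : (Nat.card G : ℚ) ≠ 0 := by exact_mod_cast Nat.card_pos.ne'
  rw [hc] at h0
  rw [key, hc, mul_div_mul_left _ _ (left_ne_zero_of_mul h0)]

/-- If passing to a quotient preserves `alpha`, it preserves the totients of the orders. -/
theorem totient_orderOf_map_eq {G Q : Type*} [Group G] [Group Q] [Fintype G] [Fintype Q]
    (f : G →* Q) (hf : Function.Surjective f) (h : alpha G = alpha Q) (g : G) :
    Nat.totient (orderOf (f g)) = Nat.totient (orderOf g) := by
  have hle : ∀ g ∈ (Finset.univ : Finset G), ((Nat.totient (orderOf g) : ℚ))⁻¹ ≤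
      ((Nat.totient (orderOf (f g)) : ℚ))⁻¹ := by
    intro g _
    have hpos : 0 < Nat.totient (orderOf (f g)) := Nat.totient_pos.2 (orderOf_pos _)
    have : Nat.totient (orderOf (f g)) ≤ Nat.totient (orderOf g) :=
      Nat.le_of_dvd (Nat.totient_pos.2 (orderOf_pos _))
        (Nat.totient_dvd_of_dvd (orderOf_map_dvd f g))
    gcongr
  rw [alpha, alpha, numCyclic_eq_sum_inv_totient, numCyclic_eq_sum_inv_totient,
    ← sum_comp_div_card_of_surjective f hf] at h
  have h0 : (Nat.card G : ℚ) ≠ 0 := by exact_mod_cast Nat.card_pos.ne'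
  have := (Finset.sum_eq_sum_iff_of_le hle).1 ((div_left_inj' h0).1 h) g (Finset.mem_univ g)
  exact_mod_cast (inv_injective this).symm

theorem sq_eq_one_of_map_sq_eq_one {G Q : Type*} [Group G] [Group Q] [Fintype G] [Fintype Q]
    (f : G →* Q) (hf : Function.Surjective f) (h : alpha G = alpha Q) {g : G}
    (hg : f g ^ 2 = 1) : g ^ 2 = 1 := by
  have h1 : Nat.totient (orderOf g) = 1 := by
    rw [← totient_orderOf_map_eq f hf h g, Nat.totient_eq_one_iff, ← Nat.dvd_prime Nat.prime_two]
    exact orderOf_dvd_of_pow_eq_one hg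
  rw [Nat.totient_eq_one_iff, ← Nat.dvd_prime Nat.prime_two] at h1
  exact orderOf_dvd_iff_pow_eq_one.1 h1

theorem commute_of_sq_eq_one {G : Type*} [Group G] {a b : G} (ha : a ^ 2 = 1) (hb : b ^ 2 = 1)
    (hab : (a * b) ^ 2 = 1) : Commute a b := by
  rw [pow_two] at ha hb hab
  have h1 := eq_inv_of_mul_eq_one_left hab
  rwa [mul_inv_rev, ← eq_inv_of_mul_eq_one_left ha, ← eq_inv_of_mul_eq_one_left hb] at h1

section LiftSwap

open Equiv

variable {G α : Type*} [Group G] [Finite α] (f : G →* Perm α) (hf : Function.Surjective f)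
  (h2 : ∀ g, f g ^ 2 = 1 → g ^ 2 = 1)

include hf h2

theorem commute_of_map_eq_one {n : G} (hn : f n = 1) (g : G) : Commute n g := by
  suffices H : ∀ (σ : Perm α) (g : G), f g = σ → Commute n g from H _ g rfl
  intro σ
  induction σ using Perm.swap_induction_on with
  | one =>
    intro g hg
    refine commute_of_sq_eq_one ?_ ?_ ?_ <;> apply h2 <;> simp [hn, hg]
  | swap_mul σ x y hxy ih =>
    intro g hg
    obtain ⟨s, hs⟩ := hf (swap x y)
    have hns : Commute n s := by
      refine commute_of_sq_eq_one ?_ ?_ ?_ <;> apply h2 <;> simp [hn, hs, pow_two]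
    have := hns.mul_right (ih (s⁻¹ * g) (by simp [hg, hs]))
    rwa [mul_inv_cancel_left] at this

/-- A lift of a transposition commutes with every lift of a permutation fixing its two points. -/
theorem commute_of_map_eq_swap {a b : α} {t : G} (ht : f t = swap a b) (g : G)
    (ha : f g a = a) (hb : f g b = b) : Commute t g := by
  suffices H : ∀ (σ : Perm {x // x ≠ a ∧ x ≠ b}) (g : G), f g = Perm.ofSubtype σ → Commute t g by
    have hiff : ∀ x, (f g x ≠ a ∧ f g x ≠ b) ↔ (x ≠ a ∧ x ≠ b) := by
      intro x
      rw [← (f g).injective.ne_iff (x := x) (y := a), ← (f g).injective.ne_iff (x := x) (y := b),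
        ha, hb]
    refine H ((f g).subtypePerm hiff) g (Perm.ofSubtype_subtypePerm _ ?_).symm
    intro x hx
    constructor <;> rintro rfl <;> contradiction
  intro σ
  induction σ using Perm.swap_induction_on with
  | one =>
    intro g hg
    exact (commute_of_map_eq_one f hf h2 (by simpa using hg) t).symm
  | swap_mul σ x y hxy ih =>
    intro g hg
    obtain ⟨s, hs⟩ := hf (swap x.1 y.1)
    have hcomm : Commute (swap a b) (swap x.1 y.1) := by
      have := swap_apply_apply (swap x.1 y.1) a b
      rw [swap_apply_of_ne_of_ne x.2.1.symm y.2.1.symm,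
        swap_apply_of_ne_of_ne x.2.2.symm y.2.2.symm, eq_mul_inv_iff_mul_eq] at this
      exact this
    have hts : Commute t s := by
      refine commute_of_sq_eq_one (h2 _ ?_) (h2 _ ?_) (h2 _ ?_)
      · simp [ht, pow_two]
      · simp [hs, pow_two]
      · rw [map_mul, ht, hs, hcomm.mul_pow]
        simp [pow_two]
    have := hts.mul_right (ih (s⁻¹ * g) (by
      rw [map_mul, map_inv, hg, hs, map_mul, Perm.ofSubtype_swap_eq, inv_mul_cancel_left]))
    rwa [mul_inv_cancel_left] at this

theorem exists_equivariant_lift_swap :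
    ∃ t : α → α → G, (∀ i j, f (t i j) = swap i j) ∧ (∀ i, t i i = 1) ∧
      (∀ i j, t i j = t j i) ∧ ∀ g i j, g * t i j * g⁻¹ = t (f g i) (f g j) := by
  rcases subsingleton_or_nontrivial α with hα | hα
  · exact ⟨fun _ _ => 1, fun i j => Subsingleton.elim _ _, fun _ => rfl, fun _ _ => rfl,
      fun g _ _ => by simp⟩
  obtain ⟨a, b, hab⟩ := exists_pair_ne α
  obtain ⟨t, ht⟩ := hf (swap a b)
  have hex : ∀ i j, i ≠ j → ∃ g, f g a = i ∧ f g b = j := by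
    intro i j hij
    obtain ⟨g, hg⟩ := hf (swap j (swap a i b) * swap a i)
    have h1 : swap a i b ≠ i := by
      intro h
      exact hab ((swap a i).injective (by rw [h, swap_apply_left]))
    refine ⟨g, ?_, ?_⟩
    · rw [hg, Perm.mul_apply, swap_apply_left, swap_apply_of_ne_of_ne hij h1.symm]
    · rw [hg, Perm.mul_apply, swap_apply_right]
  choose! c hca hcb using hex
  have huniq : ∀ g h : G, f g a = f h a → f g b = f h b → g * t * g⁻¹ = h * t * h⁻¹ := by
    intro g h hga hgb
    have := commute_of_map_eq_swap f hf h2 ht (h⁻¹ * g) (by simp [hga]) (by simp [hgb])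
    have h3 : t * (h⁻¹ * g) = h⁻¹ * g * t := this
    rw [mul_inv_eq_iff_eq_mul, mul_assoc, mul_assoc, h3]
    group
  let T : α → α → G := fun i j => if i = j then 1 else c i j * t * (c i j)⁻¹
  have hT : ∀ i j, i ≠ j → T i j = c i j * t * (c i j)⁻¹ := fun i j hij => if_neg hij
  have hT1 : ∀ i, T i i = 1 := fun i => if_pos rfl
  refine ⟨T, fun i j => ?_, hT1, fun i j => ?_, fun g i j => ?_⟩
  · rcases eq_or_ne i j with rfl | hij
    · simp [hT1, Perm.one_def]
    · rw [hT i j hij, map_mul, map_mul, map_inv, ht, ← swap_apply_apply, hca i j hij, hcb i j hij]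
  · rcases eq_or_ne i j with rfl | hij
    · rfl
    · rw [hT i j hij, hT j i hij.symm, huniq (c i j) (c j i * t)]
      · group
      · simp [ht, hca i j hij, hcb j i hij.symm]
      · simp [ht, hcb i j hij, hca j i hij.symm]
  · rcases eq_or_ne i j with rfl | hij
    · simp [hT1]
    · have hg : f g i ≠ f g j := (f g).injective.ne hij
      rw [hT i j hij, hT _ _ hg, ← huniq (g * c i j) (c (f g i) (f g j))]
      · group
      · simp [hca i j hij, hca _ _ hg]
      · simp [hcb i j hij, hcb _ _ hg]

end LiftSwap

section Closure

open Equiv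

variable {G α : Type*} [Group G] (f : G →* Perm α) (t : α → α → G)
  (hft : ∀ i j, f (t i j) = swap i j) (hone : ∀ i, t i i = 1) (hsymm : ∀ i j, t i j = t j i)
  (hconj : ∀ g i j, g * t i j * g⁻¹ = t (f g i) (f g j)) (hsq : ∀ i j, t i j * t i j = 1)

include hft hone hsymm hconj hsq

/-- Coset decomposition along the point stabilizer of `a` for the group generated by lifts of
transpositions. -/
theorem exists_mul_of_mem_closure_insert (S : Set α) {a : α} (ha : a ∉ S) {x : G}
    (hx : x ∈ Subgroup.closure {g | ∃ i ∈ insert a S, ∃ j ∈ insert a S, t i j = g}) :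
    ∃ y ∈ Subgroup.closure {g | ∃ i ∈ S, ∃ j ∈ S, t i j = g}, ∃ b ∈ insert a S,
      x = y * t b a := by
  have hmem : ∀ i ∈ S, ∀ j ∈ S, t i j ∈ Subgroup.closure {g | ∃ i ∈ S, ∃ j ∈ S, t i j = g} :=
    fun i hi j hj => Subgroup.subset_closure ⟨i, hi, j, hj, rfl⟩
  have hstep_a : ∀ b ∈ insert a S, ∀ j ∈ insert a S,
      ∃ y ∈ Subgroup.closure {g | ∃ i ∈ S, ∃ j ∈ S, t i j = g}, ∃ d ∈ insert a S,
        t b a * t j a = y * t d a := by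
    intro b hb j hj
    rcases eq_or_ne b a with rfl | hba
    · exact ⟨1, one_mem _, j, hj, by rw [hone]⟩
    rcases eq_or_ne j a with rfl | hja
    · exact ⟨1, one_mem _, b, hb, by simp [hone]⟩
    rcases eq_or_ne j b with rfl | hjb
    · exact ⟨1, one_mem _, a, Set.mem_insert a S, by simp [hone, hsq]⟩
    refine ⟨t j b, hmem j (Set.mem_of_mem_insert_of_ne hj hja) b
      (Set.mem_of_mem_insert_of_ne hb hba), b, hb, ?_⟩
    have := hconj (t b a) j a
    rw [hft, swap_apply_of_ne_of_ne hjb hja, swap_apply_right] at this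
    exact mul_inv_eq_iff_eq_mul.1 this
  have hstep : ∀ b ∈ insert a S, ∀ i ∈ insert a S, ∀ j ∈ insert a S,
      ∃ y ∈ Subgroup.closure {g | ∃ i ∈ S, ∃ j ∈ S, t i j = g}, ∃ d ∈ insert a S,
        t b a * t i j = y * t d a := by
    intro b hb i hi j hj
    rcases eq_or_ne j a with rfl | hja
    · exact hstep_a b hb i hi
    rcases eq_or_ne i a with rfl | hia
    · rw [hsymm i j]
      exact hstep_a b hb j hj
    have hiS := Set.mem_of_mem_insert_of_ne hi hia
    have hjS := Set.mem_of_mem_insert_of_ne hj hja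
    refine ⟨t i j, hmem i hiS j hjS, swap i j b, ?_, ?_⟩
    · rw [swap_apply_def]
      split_ifs <;> assumption
    · have := hconj (t i j) b a
      rw [hft, swap_apply_of_ne_of_ne hia.symm hja.symm,
        inv_eq_of_mul_eq_one_left (hsq i j)] at this
      rw [← this, ← mul_assoc, ← mul_assoc, hsq, one_mul]
  have hmul : ∀ x, (∃ y ∈ Subgroup.closure {g | ∃ i ∈ S, ∃ j ∈ S, t i j = g},
      ∃ b ∈ insert a S, x = y * t b a) → ∀ i ∈ insert a S, ∀ j ∈ insert a S,
      ∃ y ∈ Subgroup.closure {g | ∃ i ∈ S, ∃ j ∈ S, t i j = g},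
        ∃ b ∈ insert a S, x * t i j = y * t b a := by
    rintro x ⟨y, hy, b, hb, rfl⟩ i hi j hj
    obtain ⟨z, hz, d, hd, h⟩ := hstep b hb i hi j hj
    exact ⟨y * z, mul_mem hy hz, d, hd, by rw [mul_assoc, h, mul_assoc]⟩
  induction hx using Subgroup.closure_induction_right with
  | one => exact ⟨1, one_mem _, a, Set.mem_insert a S, by simp [hone]⟩
  | mul_right x _ y hy ih =>
    obtain ⟨i, hi, j, hj, rfl⟩ := hy
    exact hmul x ih i hi j hj
  | mul_inv_cancel x _ y hy ih =>
    obtain ⟨i, hi, j, hj, rfl⟩ := hy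
    rw [inv_eq_of_mul_eq_one_left (hsq i j)]
    exact hmul x ih i hi j hj

theorem eq_one_of_mem_closure_of_map_eq_one [Finite α] {x : G}
    (hx : x ∈ Subgroup.closure {g | ∃ i j, t i j = g}) (hfx : f x = 1) : x = 1 := by
  suffices H : ∀ S : Set α, ∀ x ∈ Subgroup.closure {g | ∃ i ∈ S, ∃ j ∈ S, t i j = g},
      f x = 1 → x = 1 from H Set.univ x (by simpa using hx) hfx
  intro S
  induction S, S.toFinite using Set.Finite.induction_on with
  | empty =>
    intro x hx _
    simpa using hx
  | @insert a S ha _ ih =>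
    intro x hx hfx
    obtain ⟨y, hy, b, hb, rfl⟩ :=
      exists_mul_of_mem_closure_insert f t hft hone hsymm hconj hsq S ha hx
    have hfix : ∀ y ∈ Subgroup.closure {g | ∃ i ∈ S, ∃ j ∈ S, t i j = g}, f y a = a := by
      intro y hy
      have hle : Subgroup.closure {g | ∃ i ∈ S, ∃ j ∈ S, t i j = g} ≤
          (MulAction.stabilizer (Perm α) a).comap f := by
        rw [Subgroup.closure_le]
        rintro _ ⟨i, hi, j, hj, rfl⟩
        change f (t i j) a = a
        rw [hft, swap_apply_of_ne_of_ne] <;> rintro rfl <;> contradiction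
      exact hle hy
    have h1 : f y b = a := by
      have := congrArg (fun σ : Perm α => σ a) hfx
      simpa [hft] using this
    have hba : b = a := (f y).injective (h1.trans (hfix y hy).symm)
    subst hba
    rw [hone, mul_one] at hfx ⊢
    exact ih y hy hfx

end Closure

/-- An extension of a symmetric group in which all lifts of involutions are involutions has a
normal complement to the kernel. -/
theorem exists_normal_complement_ker {G α : Type*} [Group G] [Finite α]
    (f : G →* Equiv.Perm α) (hf : Function.Surjective f) (h2 : ∀ g, f g ^ 2 = 1 → g ^ 2 = 1) :
    ∃ H : Subgroup G, H.Normal ∧ f.ker ⊓ H = ⊥ ∧ f.ker ⊔ H = ⊤ := by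
  obtain ⟨t, hft, hone, hsymm, hconj⟩ := exists_equivariant_lift_swap f hf h2
  have hsq : ∀ i j, t i j * t i j = 1 := by
    intro i j
    rw [← pow_two]
    apply h2
    simp [hft, pow_two]
  refine ⟨Subgroup.closure {g | ∃ i j, t i j = g}, ?_, ?_, ?_⟩
  · constructor
    intro n hn g
    have hle : Subgroup.closure {g | ∃ i j, t i j = g} ≤
        (Subgroup.closure {g | ∃ i j, t i j = g}).comap (MulAut.conj g).toMonoidHom := by
      rw [Subgroup.closure_le]
      rintro _ ⟨i, j, rfl⟩
      exact Subgroup.subset_closure ⟨_, _, (hconj g i j).symm⟩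
    exact hle hn
  · rw [eq_bot_iff]
    rintro x ⟨hx, hx'⟩
    exact eq_one_of_mem_closure_of_map_eq_one f t hft hone hsymm hconj hsq hx' hx
  · have hmap : (Subgroup.closure {g | ∃ i j, t i j = g}).map f = ⊤ := by
      rw [eq_top_iff, ← Equiv.Perm.closure_isSwap, Subgroup.closure_le]
      rintro _ ⟨i, j, _, rfl⟩
      exact ⟨t i j, Subgroup.subset_closure ⟨i, j, rfl⟩, hft i j⟩
    rw [sup_comm, ← Subgroup.comap_map_eq, hmap, Subgroup.comap_top]

/-- A group is the product of a normal subgroup with a normal complement and the quotient. -/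
theorem nonempty_mulEquiv_prod_quotient {G : Type*} [Group G] (N H : Subgroup G) [N.Normal]
    (hH : H.Normal) (hinf : N ⊓ H = ⊥) (hsup : N ⊔ H = ⊤) : Nonempty (G ≃* N × (G ⧸ N)) := by
  have hcompl : ∀ x ∈ N, x ∈ H → x = 1 := fun x hx hx' =>
    Subgroup.mem_bot.1 (hinf ▸ Subgroup.mem_inf.2 ⟨hx, hx'⟩)
  have hdecomp : ∀ g : G, ∃ n ∈ N, ∃ k ∈ H, n * k = g := fun g =>
    Subgroup.mem_sup_of_normal_left.1 (hsup ▸ Subgroup.mem_top g)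
  let e : H →* G ⧸ N := (QuotientGroup.mk' N).comp H.subtype
  have he : Function.Bijective e := by
    constructor
    · rw [injective_iff_map_eq_one]
      intro x hx
      exact Subtype.ext (hcompl x ((QuotientGroup.eq_one_iff _).1 hx) x.2)
    · intro q
      obtain ⟨g, rfl⟩ := QuotientGroup.mk'_surjective N q
      obtain ⟨n, hn, k, hk, rfl⟩ := hdecomp g
      refine ⟨⟨k, hk⟩, ?_⟩
      have : QuotientGroup.mk' N n = 1 := (QuotientGroup.eq_one_iff _).2 hn
      rw [map_mul, this, one_mul]
      rfl
  have hcomm : ∀ (n : N) (k : H), Commute (N.subtype n) (H.subtype k) := fun n k =>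
    Subgroup.commute_of_normal_of_disjoint N H inferInstance hH (disjoint_iff.2 hinf) n k n.2 k.2
  let p : N × H →* G := MonoidHom.noncommCoprod N.subtype H.subtype hcomm
  have hp : Function.Bijective p := by
    constructor
    · rw [injective_iff_map_eq_one]
      rintro ⟨n, k⟩ hnk
      have hnk' : (n : G) * k = 1 := hnk
      have hn : (n : G) = 1 := by
        refine hcompl n n.2 ?_
        rw [eq_inv_of_mul_eq_one_left hnk']
        exact inv_mem k.2
      rw [hn, one_mul] at hnk'
      exact Prod.ext (Subtype.ext hn) (Subtype.ext hnk')
    · intro g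
      obtain ⟨n, hn, k, hk, rfl⟩ := hdecomp g
      exact ⟨(⟨n, hn⟩, ⟨k, hk⟩), rfl⟩
  exact ⟨(MulEquiv.ofBijective p hp).symm.trans
    ((MulEquiv.refl N).prodCongr (MulEquiv.ofBijective e he))⟩

theorem stmt_9 (G : Type*) [Group G] [Fintype G] (N : Subgroup G) [N.Normal]
    (m : ℕ) (hiso : Nonempty ((G ⧸ N) ≃* Equiv.Perm (Fin m)))
    (h : alpha G = alpha (G ⧸ N)) :
    (∀ n ∈ N, n ^ 2 = 1) ∧
      (∃ H : Subgroup G, H.Normal ∧ N ⊓ H = ⊥ ∧ N ⊔ H = ⊤) ∧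
      Nonempty (G ≃* (↥N) × (G ⧸ N)) := by
  obtain ⟨e⟩ := hiso
  have hsurj : Function.Surjective (QuotientGroup.mk' N) := QuotientGroup.mk'_surjective N
  have h2 : ∀ g : G, QuotientGroup.mk' N g ^ 2 = 1 → g ^ 2 = 1 := fun g hg =>
    sq_eq_one_of_map_sq_eq_one (QuotientGroup.mk' N) hsurj h hg
  let f : G →* Equiv.Perm (Fin m) := e.toMonoidHom.comp (QuotientGroup.mk' N)
  have hker : f.ker = N := by
    ext g
    change e (QuotientGroup.mk' N g) = 1 ↔ g ∈ N
    rw [map_eq_one_iff e e.injective]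
    exact QuotientGroup.eq_one_iff g
  obtain ⟨H, hH, hinf, hsup⟩ := exists_normal_complement_ker f (e.surjective.comp hsurj) (by
    intro g hg
    apply h2
    apply e.injective
    rw [map_pow, map_one]
    exact hg)
  rw [hker] at hinf hsup
  refine ⟨fun n hn => h2 n ?_, ⟨H, hH, hinf, hsup⟩,
    nonempty_mulEquiv_prod_quotient N H hH hinf hsup⟩
  have : QuotientGroup.mk' N n = 1 := (QuotientGroup.eq_one_iff n).2 hn
  rw [this, one_pow]
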